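/- For 0<q<p≤1, n∈ℕ with n≥1, and x≥0, the King-type (p,q)-Baskakov operator preserves the test function x²: B*_{n,p,q}(t²;x) = x². -/

import Mathlib

open Real Set Filter

/-- The (p,q)-integer [n]_{p,q} = (p^n - q^n)/(p - q). -/
noncomputable def pqInt (p q : ℝ) (n : ℕ) : ℝ := (p ^ n - q ^ n) / (p - q)

/-- The (p,q)-factorial [n]_{p,q}! . -/
noncomputable def pqFact (p q : ℝ) : ℕ → ℝ
  | 0 => 1
  | n + 1 => pqInt p q (n + 1) * pqFact p q n

/-- The (p,q)-binomial coefficient. -/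
noncomputable def pqChoose (p q : ℝ) (n k : ℕ) : ℝ :=
  pqFact p q n / (pqFact p q k * pqFact p q (n - k))

/-- (1 ⊕ x)^n_{p,q} = ∏_{j=0}^{n-1} (p^j + q^j x). -/
noncomputable def pqOnePlusPow (p q x : ℝ) (n : ℕ) : ℝ :=
  ∏ j ∈ Finset.range n, (p ^ j + q ^ j * x)

/-- The (p,q)-Baskakov operator B_{n,p,q}(f;x). -/
noncomputable def baskakov (p q : ℝ) (n : ℕ) (f : ℝ → ℝ) (x : ℝ) : ℝ :=
  ∑' k : ℕ, pqChoose p q (n + k - 1) k * p ^ (k + n * (n - 1) / 2) *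
    q ^ (k * (k - 1) / 2) * (x ^ k / pqOnePlusPow p q x (n + k)) *
    f (p ^ (n - 1) * pqInt p q k / (q ^ (k - 1) * pqInt p q n))

/-- The function r_n(x) used in the King-type modification. -/
noncomputable def rn (p q : ℝ) (n : ℕ) (x : ℝ) : ℝ :=
  (-(p ^ (n - 1)) +
      Real.sqrt (p ^ (2 * n - 2) + 4 * pqInt p q n * (pqInt p q n + p ^ n / q) * x ^ 2)) /
    (2 * (pqInt p q n + p ^ n / q))

/-- The King-type (p,q)-Baskakov operator B*_{n,p,q}(f;x) = B_{n,p,q}(f; r_n(x)). -/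
noncomputable def kingBaskakov (p q : ℝ) (n : ℕ) (f : ℝ → ℝ) (x : ℝ) : ℝ :=
  baskakov p q n f (rn p q n x)

theorem pqInt_pos {p q : ℝ} (hq : 0 < q) (hqp : q < p) (n : ℕ) : 0 < pqInt p q (n + 1) :=
  div_pos (sub_pos.2 (pow_lt_pow_left₀ hqp hq.le n.succ_ne_zero)) (sub_pos.2 hqp)

theorem pqFact_pos {p q : ℝ} (hq : 0 < q) (hqp : q < p) (n : ℕ) : 0 < pqFact p q n := by
  induction n with
  | zero => exact one_pos
  | succ n ih => exact mul_pos (pqInt_pos hq hqp n) ih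

theorem pqInt_zero (p q : ℝ) : pqInt p q 0 = 0 := by simp [pqInt]

theorem pqInt_one {p q : ℝ} (hqp : q < p) : pqInt p q 1 = 1 := by
  simp [pqInt, div_self (sub_pos.2 hqp).ne']

theorem pqInt_add (p q : ℝ) (a b : ℕ) :
    pqInt p q (a + b) = pqInt p q a * p ^ b + pqInt p q b * q ^ a := by
  simp only [pqInt, pow_add]
  ring

theorem pqOnePlusPow_succ (p q x : ℝ) (n : ℕ) :
    pqOnePlusPow p q x (n + 1) = pqOnePlusPow p q x n * (p ^ n + q ^ n * x) :=
  Finset.prod_range_succ _ _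

theorem pow_add_pow_mul_pos {p q x : ℝ} (hq : 0 < q) (hqp : q < p) (hx : 0 ≤ x) (n : ℕ) :
    0 < p ^ n + q ^ n * x := by
  have := hq.trans hqp
  positivity

theorem pqOnePlusPow_pos {p q x : ℝ} (hq : 0 < q) (hqp : q < p) (hx : 0 ≤ x) (n : ℕ) :
    0 < pqOnePlusPow p q x n :=
  Finset.prod_pos fun j _ => pow_add_pow_mul_pos hq hqp hx j

/-- The probability of `s` successes and `f` failures in `s + f` independent trials, where trial
`j` succeeds with probability `p ^ j / (p ^ j + q ^ j * x)`. -/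
noncomputable def trialProb (p q x : ℝ) (s f : ℕ) : ℝ :=
  pqFact p q (s + f) / (pqFact p q f * pqFact p q s) * p ^ (s * (s - 1) / 2) *
    q ^ (f * (f - 1) / 2) * (x ^ f / pqOnePlusPow p q x (s + f))

/-- The probability of exactly `f` failures before success number `s + 1`. -/
noncomputable def waitProb (p q x : ℝ) (s f : ℕ) : ℝ :=
  trialProb p q x s f * (p ^ (s + f) / (p ^ (s + f) + q ^ (s + f) * x))

section

variable {p q x : ℝ} (hq : 0 < q) (hqp : q < p) (hx : 0 ≤ x)
include hq hqp hx

theorem trialProb_nonneg (s f : ℕ) : 0 ≤ trialProb p q x s f := by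
  have := hq.trans hqp
  have := pqFact_pos hq hqp (s + f)
  have := pqFact_pos hq hqp s
  have := pqFact_pos hq hqp f
  have := pqOnePlusPow_pos hq hqp hx (s + f)
  unfold trialProb
  positivity

theorem waitProb_nonneg (s f : ℕ) : 0 ≤ waitProb p q x s f := by
  have := hq.trans hqp
  have := pow_add_pow_mul_pos hq hqp hx (s + f)
  have := trialProb_nonneg hq hqp hx s f
  unfold waitProb
  positivity

theorem trialProb_le_waitProb (s f : ℕ) :
    trialProb p q x s f ≤ (1 + x) * waitProb p q x s f := by
  have hD := pow_add_pow_mul_pos hq hqp hx (s + f)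
  have h1 : 1 ≤ (1 + x) * (p ^ (s + f) / (p ^ (s + f) + q ^ (s + f) * x)) := by
    rw [← mul_div_assoc, le_div_iff₀ hD]
    nlinarith [mul_le_mul_of_nonneg_right (pow_le_pow_left₀ hq.le hqp.le (s + f)) hx]
  have := mul_le_mul_of_nonneg_left h1 (trialProb_nonneg hq hqp hx s f)
  unfold waitProb
  linarith

theorem trialProb_zero_succ (f : ℕ) :
    trialProb p q x 0 (f + 1) = trialProb p q x 0 f - waitProb p q x 0 f := by
  have := (pqFact_pos hq hqp f).ne'
  have := (pqInt_pos hq hqp f).ne'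
  have := (pqOnePlusPow_pos hq hqp hx f).ne'
  have := (pow_add_pow_mul_pos hq hqp hx f).ne'
  have hF : pqFact p q (f + 1) = pqInt p q (f + 1) * pqFact p q f := rfl
  simp only [waitProb, trialProb, zero_add, Nat.triangle_succ, hF, pqOnePlusPow_succ]
  field_simp
  ring

theorem trialProb_succ_zero (s : ℕ) : trialProb p q x (s + 1) 0 = waitProb p q x s 0 := by
  have := (pqFact_pos hq hqp s).ne'
  have := (pqInt_pos hq hqp s).ne'
  have := (pqOnePlusPow_pos hq hqp hx s).ne'
  have := (pow_add_pow_mul_pos hq hqp hx s).ne'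
  simp only [waitProb, trialProb, add_zero, Nat.triangle_succ, pqFact, pqOnePlusPow_succ]
  field_simp
  ring

theorem trialProb_succ_succ (s f : ℕ) :
    trialProb p q x (s + 1) (f + 1) =
      waitProb p q x s (f + 1) + trialProb p q x (s + 1) f - waitProb p q x (s + 1) f := by
  have := (pqFact_pos hq hqp s).ne'
  have := (pqInt_pos hq hqp s).ne'
  have := (pqFact_pos hq hqp f).ne'
  have := (pqInt_pos hq hqp f).ne'
  have := (pqOnePlusPow_pos hq hqp hx (s + f + 1)).ne'
  have := (pow_add_pow_mul_pos hq hqp hx (s + f + 1)).ne'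
  have e1 : s + 1 + (f + 1) = s + f + 1 + 1 := by ring
  have e2 : s + (f + 1) = s + f + 1 := by ring
  have e3 : s + 1 + f = s + f + 1 := by ring
  have hI : pqInt p q (s + f + 1 + 1) =
      pqInt p q (s + 1) * p ^ (f + 1) + pqInt p q (f + 1) * q ^ (s + 1) := by
    rw [← e1, pqInt_add]
  have hF : pqFact p q (s + f + 1 + 1) = pqInt p q (s + f + 1 + 1) * pqFact p q (s + f + 1) := rfl
  have hs : pqFact p q (s + 1) = pqInt p q (s + 1) * pqFact p q s := rfl
  have hf : pqFact p q (f + 1) = pqInt p q (f + 1) * pqFact p q f := rfl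
  simp only [waitProb, trialProb, e1, e2, e3, Nat.triangle_succ, hF, hs, hf, hI,
    pqOnePlusPow_succ _ _ _ (s + f + 1)]
  generalize pqOnePlusPow p q x (s + f + 1) = P at *
  field_simp
  ring

theorem sum_waitProb_zero (m : ℕ) :
    ∑ f ∈ Finset.range m, waitProb p q x 0 f = 1 - trialProb p q x 0 m := by
  induction m with
  | zero => simp [trialProb, pqFact, pqOnePlusPow]
  | succ m ih =>
    rw [Finset.sum_range_succ, ih, trialProb_zero_succ hq hqp hx]
    ring

theorem sum_waitProb_succ (s m : ℕ) :
    ∑ f ∈ Finset.range m, waitProb p q x (s + 1) f =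
      ∑ f ∈ Finset.range (m + 1), waitProb p q x s f - trialProb p q x (s + 1) m := by
  induction m with
  | zero => simp [trialProb_succ_zero hq hqp hx]
  | succ m ih =>
    rw [Finset.sum_range_succ, ih, Finset.sum_range_succ _ (m + 1),
      trialProb_succ_succ hq hqp hx]
    ring

theorem sum_waitProb_le_one (s m : ℕ) : ∑ f ∈ Finset.range m, waitProb p q x s f ≤ 1 := by
  induction s generalizing m with
  | zero =>
    rw [sum_waitProb_zero hq hqp hx]
    linarith [trialProb_nonneg hq hqp hx 0 m]
  | succ s ih =>
    rw [sum_waitProb_succ hq hqp hx]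
    linarith [trialProb_nonneg hq hqp hx (s + 1) m, ih (m + 1)]

theorem tendsto_trialProb (s : ℕ) : Tendsto (trialProb p q x s) atTop (nhds 0) := by
  have hs : Summable (waitProb p q x s) :=
    summable_of_sum_range_le (waitProb_nonneg hq hqp hx s) (sum_waitProb_le_one hq hqp hx s)
  have := hs.tendsto_atTop_zero.const_mul (1 + x)
  rw [mul_zero] at this
  exact squeeze_zero (trialProb_nonneg hq hqp hx s) (trialProb_le_waitProb hq hqp hx s) this

theorem hasSum_waitProb (s : ℕ) : HasSum (waitProb p q x s) 1 := by
  rw [hasSum_iff_tendsto_nat_of_nonneg (waitProb_nonneg hq hqp hx s)]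
  induction s with
  | zero =>
    simpa only [sum_waitProb_zero hq hqp hx, sub_zero] using
      (tendsto_trialProb hq hqp hx 0).const_sub 1
  | succ s ih =>
    simpa only [sum_waitProb_succ hq hqp hx, sub_zero] using
      ((tendsto_add_atTop_iff_nat 1).2 ih).sub (tendsto_trialProb hq hqp hx (s + 1))

theorem waitProb_succ_mul (s f : ℕ) :
    waitProb p q x s (f + 1) * (p ^ s * pqInt p q (f + 1) / (q ^ f * pqInt p q (s + 1))) =
      x * waitProb p q x (s + 1) f := by
  have := (hq.trans hqp).ne'
  have := (pqFact_pos hq hqp s).ne'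
  have := (pqInt_pos hq hqp s).ne'
  have := (pqFact_pos hq hqp f).ne'
  have := (pqInt_pos hq hqp f).ne'
  have := (pqOnePlusPow_pos hq hqp hx (s + f + 1)).ne'
  have := (pow_add_pow_mul_pos hq hqp hx (s + f + 1)).ne'
  have e2 : s + (f + 1) = s + f + 1 := by ring
  have e3 : s + 1 + f = s + f + 1 := by ring
  have hs : pqFact p q (s + 1) = pqInt p q (s + 1) * pqFact p q s := rfl
  have hf : pqFact p q (f + 1) = pqInt p q (f + 1) * pqFact p q f := rfl
  simp only [waitProb, trialProb, e2, e3, Nat.triangle_succ, hs, hf]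
  generalize pqOnePlusPow p q x (s + f + 1) = P at *
  field_simp
  ring

theorem hasSum_waitProb_mul (s : ℕ) :
    HasSum (fun f => waitProb p q x s f *
      (p ^ s * pqInt p q f / (q ^ (f - 1) * pqInt p q (s + 1)))) x := by
  rw [← hasSum_nat_add_iff' 1]
  simpa [waitProb_succ_mul hq hqp hx, pqInt_zero] using
    (hasSum_waitProb hq hqp hx (s + 1)).mul_left x

theorem hasSum_waitProb_mul_sq (s : ℕ) :
    HasSum (fun f => waitProb p q x s f *
      (p ^ s * pqInt p q f / (q ^ (f - 1) * pqInt p q (s + 1))) ^ 2)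
      (p ^ s * x / pqInt p q (s + 1) + x ^ 2 * pqInt p q (s + 2) / (q * pqInt p q (s + 1))) := by
  have hp0 := (hq.trans hqp).ne'
  have hs := (pqInt_pos hq hqp s).ne'
  have hs' := (pqInt_pos hq hqp (s + 1)).ne'
  rw [← hasSum_nat_add_iff' 1]
  have h := ((hasSum_waitProb hq hqp hx (s + 1)).mul_left (p ^ s * x / pqInt p q (s + 1))).add
    ((hasSum_waitProb_mul hq hqp hx (s + 1)).mul_left
      (x * pqInt p q (s + 2) / (q * pqInt p q (s + 1))))
  refine (congrArg₂ (fun g a => HasSum g a) (funext fun f => ?_) ?_).mpr h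
  · simp only [Nat.add_sub_cancel]
    rw [pow_two, ← mul_assoc, waitProb_succ_mul hq hqp hx, pqInt_add p q f 1, pqInt_one hqp]
    rcases f with _ | f
    · simp only [pqInt_zero]
      field_simp
      ring
    · simp only [Nat.add_sub_cancel]
      field_simp
      ring
  · simp [pqInt_zero]
    field_simp

theorem baskakov_sq (s : ℕ) :
    baskakov p q (s + 1) (fun t => t ^ 2) x =
      p ^ s * x / pqInt p q (s + 1) + x ^ 2 * pqInt p q (s + 2) / (q * pqInt p q (s + 1)) := by
  rw [← (hasSum_waitProb_mul_sq hq hqp hx s).tsum_eq]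
  refine tsum_congr fun k => ?_
  have e2 : s + 1 + k = s + k + 1 := by ring
  have := (pqOnePlusPow_pos hq hqp hx (s + k)).ne'
  have := (pow_add_pow_mul_pos hq hqp hx (s + k)).ne'
  congr 1
  simp only [pqChoose, waitProb, trialProb, e2, Nat.add_sub_cancel, pqOnePlusPow_succ]
  have e3 : (s + 1) * s / 2 = s * (s - 1) / 2 + s := Nat.triangle_succ s
  rw [e3]
  generalize pqOnePlusPow p q x (s + k) = P at *
  field_simp
  ring

end

theorem rn_nonneg {p q : ℝ} (hq : 0 < q) (hqp : q < p) (s : ℕ) (x : ℝ) :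
    0 ≤ rn p q (s + 1) x := by
  have hp0 := hq.trans hqp
  have hs := pqInt_pos hq hqp s
  refine div_nonneg ?_ (by positivity)
  have : p ^ s ≤ √(p ^ (2 * (s + 1) - 2) +
      4 * pqInt p q (s + 1) * (pqInt p q (s + 1) + p ^ (s + 1) / q) * x ^ 2) := by
    refine Real.le_sqrt_of_sq_le ?_
    rw [show 2 * (s + 1) - 2 = s * 2 by omega, pow_mul]
    exact le_add_of_nonneg_right (by positivity)
  simp only [Nat.add_sub_cancel]
  linarith

theorem rn_quadratic {p q : ℝ} (hq : 0 < q) (hqp : q < p) (s : ℕ) (x : ℝ) :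
    (pqInt p q (s + 1) + p ^ (s + 1) / q) * rn p q (s + 1) x ^ 2 + p ^ s * rn p q (s + 1) x =
      pqInt p q (s + 1) * x ^ 2 := by
  have hp0 := hq.trans hqp
  have hs := pqInt_pos hq hqp s
  have hA : 0 < pqInt p q (s + 1) + p ^ (s + 1) / q := by positivity
  unfold rn
  rw [show 2 * (s + 1) - 2 = s * 2 by omega, pow_mul, Nat.add_sub_cancel]
  generalize pqInt p q (s + 1) + p ^ (s + 1) / q = A at *
  have hS := Real.sq_sqrt (show 0 ≤ (p ^ s) ^ 2 + 4 * pqInt p q (s + 1) * A * x ^ 2 by positivity)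
  generalize √((p ^ s) ^ 2 + 4 * pqInt p q (s + 1) * A * x ^ 2) = r at *
  field_simp
  linear_combination hS

theorem kingBaskakov_preserves_sq (p q : ℝ) (n : ℕ) (x : ℝ)
    (hq : 0 < q) (hqp : q < p) (hp : p ≤ 1) (hn : 1 ≤ n) (hx : 0 ≤ x) :
    kingBaskakov p q n (fun t => t ^ 2) x = x ^ 2 := by
  obtain ⟨s, rfl⟩ := Nat.exists_eq_add_of_le' hn
  have hs := (pqInt_pos hq hqp s).ne'
  have h := rn_quadratic hq hqp s x
  have hI : pqInt p q (s + 2) = p ^ (s + 1) + pqInt p q (s + 1) * q := by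
    rw [show s + 2 = 1 + (s + 1) by ring, pqInt_add p q 1 (s + 1), pqInt_one hqp, one_mul, pow_one]
  rw [kingBaskakov, baskakov_sq hq hqp (rn_nonneg hq hqp s x), hI]
  field_simp at h ⊢
  linear_combination h
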